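/- Every Ito–Sadahiro number β > 1 is an algebraic integer whose degree over ℚ is at most m + p, where m ≥ 0 and p ≥ 1 are such that the (−β)-expansion d_1 d_2 d_3 … of l_β satisfies d_{i+p} = d_i for all i > m. -/

import Mathlib

/-- `l_β = -β/(β+1)` -/
noncomputable def ISl (β : ℝ) : ℝ := -β / (β + 1)

/-- The Ito–Sadahiro transformation `T(x) = -βx - ⌊-βx - l_β⌋`. -/
noncomputable def IST (β : ℝ) (x : ℝ) : ℝ := -β * x - ⌊-β * x - ISl β⌋

/-- The `i`-th `(-β)`-digit of `x` (for `i ≥ 1`): `x_i = ⌊-β T^{i-1}(x) - l_β⌋`. -/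
noncomputable def ISdigit (β x : ℝ) (i : ℕ) : ℤ := ⌊-β * (IST β)^[i - 1] x - ISl β⌋

open Polynomial in
/-- The polynomials `P n` of degree `< n` with `T^n(x) = (-β)^n x + P n (-β)`. -/
noncomputable def ISpoly (d : ℕ → ℤ) : ℕ → ℤ[X]
  | 0 => 0
  | n + 1 => X * ISpoly d n - C (d (n + 1))

open Polynomial in
theorem ISpoly_degree_lt (d : ℕ → ℤ) (n : ℕ) : (ISpoly d n).degree < n := by
  induction n with
  | zero => simp [ISpoly]
  | succ n ih =>
    rw [ISpoly, degree_lt_iff_coeff_zero]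
    rw [degree_lt_iff_coeff_zero] at ih
    intro k hk
    obtain ⟨j, rfl⟩ : ∃ j, k = j + 1 := ⟨k - 1, by omega⟩
    rw [coeff_sub, coeff_X_mul, coeff_C_succ, ih j (by omega), sub_zero]

theorem IST_iterate_succ (β x : ℝ) (n : ℕ) :
    (IST β)^[n + 1] x = -β * (IST β)^[n] x - ISdigit β x (n + 1) := by
  rw [Function.iterate_succ_apply']
  simp [IST, ISdigit]

open Polynomial in
theorem IST_iterate_eq_aeval (β x : ℝ) (n : ℕ) :
    (IST β)^[n] x = (-β) ^ n * x + aeval (-β) (ISpoly (ISdigit β x) n) := by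
  induction n with
  | zero => simp [ISpoly]
  | succ n ih =>
    rw [IST_iterate_succ, ih, ISpoly]
    simp only [map_sub, map_mul, aeval_X, eq_intCast, map_intCast]
    ring

theorem IST_iterate_mem (β : ℝ) (n : ℕ) :
    (IST β)^[n] (ISl β) ∈ Set.Ico (ISl β) (ISl β + 1) := by
  cases n with
  | zero => simp
  | succ n =>
    rw [Function.iterate_succ_apply']
    set y := (IST β)^[n] (ISl β)
    have h₁ := Int.floor_le (-β * y - ISl β)
    have h₂ := Int.lt_floor_add_one (-β * y - ISl β)
    constructor <;> simp only [IST] <;> linarith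

/-- If the digits of `l_β` are periodic from index `m + 1` on, then so is its orbit from `m` on. -/
theorem IST_iterate_add_period {β : ℝ} (hβ : 1 < β) {m p : ℕ}
    (hper : ∀ i : ℕ, m < i → ISdigit β (ISl β) (i + p) = ISdigit β (ISl β) i) :
    (IST β)^[m + p] (ISl β) = (IST β)^[m] (ISl β) := by
  have key : ∀ k : ℕ, (IST β)^[m + k + p] (ISl β) - (IST β)^[m + k] (ISl β)
      = (-β) ^ k * ((IST β)^[m + p] (ISl β) - (IST β)^[m] (ISl β)) := by
    intro k
    induction k with
    | zero => simp
    | succ k ih =>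
      have h := hper (m + k + 1) (by omega)
      rw [show m + (k + 1) + p = m + k + p + 1 by ring, ← add_assoc m k 1,
        IST_iterate_succ, IST_iterate_succ, show m + k + p + 1 = m + k + 1 + p by ring, h,
        pow_succ']
      linear_combination (-β) * ih
  by_contra hne
  have hpos := abs_pos.2 (sub_ne_zero.2 hne)
  obtain ⟨k, hk⟩ := pow_unbounded_of_one_lt
    (1 / |(IST β)^[m + p] (ISl β) - (IST β)^[m] (ISl β)|) hβ
  rw [div_lt_iff₀ hpos] at hk
  have h := congrArg abs (key k)
  rw [abs_mul, abs_pow, abs_neg, abs_of_pos (by linarith : 0 < β)] at h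
  obtain ⟨h₁, h₂⟩ := IST_iterate_mem β (m + k + p)
  obtain ⟨h₃, h₄⟩ := IST_iterate_mem β (m + k)
  have hlt : |(IST β)^[m + k + p] (ISl β) - (IST β)^[m + k] (ISl β)| < 1 :=
    abs_lt.2 ⟨by linarith, by linarith⟩
  linarith

open Polynomial in
theorem exists_monic_aeval_neg_eq_zero {β : ℝ} (hβ : 1 < β) {m p : ℕ} (hp : 1 ≤ p)
    (hper : ∀ i : ℕ, m < i → ISdigit β (ISl β) (i + p) = ISdigit β (ISl β) i) :
    ∃ Q : ℤ[X], Q.Monic ∧ Q.natDegree = m + p ∧ aeval (-β) Q = 0 := by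
  obtain ⟨q, rfl⟩ : ∃ q, p = q + 1 := ⟨p - 1, by omega⟩
  set P := ISpoly (ISdigit β (ISl β))
  set R : ℤ[X] := X ^ (m + 1) * ∑ i ∈ Finset.range q, X ^ i - (P (m + (q + 1)) - P m) with hR
  have hdeg : R.degree < ((m + (q + 1) : ℕ) : WithBot ℕ) := by
    rw [← mem_degreeLT]
    refine Submodule.sub_mem _ ?_ (Submodule.sub_mem _ ?_ ?_)
    · rw [Finset.mul_sum]
      refine Submodule.sum_mem _ fun i hi => ?_
      rw [mem_degreeLT, ← pow_add, degree_X_pow]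
      have := Finset.mem_range.1 hi
      exact_mod_cast (by omega : m + 1 + i < m + (q + 1))
    · exact mem_degreeLT.2 (ISpoly_degree_lt _ _)
    · refine mem_degreeLT.2 ((ISpoly_degree_lt _ _).trans_le ?_)
      exact_mod_cast (by omega : m ≤ m + (q + 1))
  refine ⟨X ^ (m + (q + 1)) + R, monic_X_pow_add hdeg, ?_, ?_⟩
  · rw [natDegree_add_eq_left_of_degree_lt (by rwa [degree_X_pow]), natDegree_X_pow]
  · have h := IST_iterate_add_period hβ hper
    rw [IST_iterate_eq_aeval, IST_iterate_eq_aeval] at h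
    have hl : (1 + β) * ISl β = -β := by
      rw [ISl]
      field_simp
      ring
    have hg := geom_sum_mul (-β) q
    simp only [hR, map_add, map_sub, map_mul, map_pow, aeval_X, map_sum]
    have hβ' : 1 + β ≠ 0 := by linarith
    refine (mul_eq_zero.1 ?_).resolve_left hβ'
    linear_combination (-(1 + β)) * h + ((-β) ^ (m + (q + 1)) - (-β) ^ m) * hl
      - (-β) ^ (m + 1) * hg

/-- An Ito–Sadahiro number is an algebraic integer of degree at most `m + p`. -/
theorem ito_sadahiro_algebraic_integer (β : ℝ) (hβ : 1 < β) (m p : ℕ) (hp : 1 ≤ p)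
    (hper : ∀ i : ℕ, m < i → ISdigit β (ISl β) (i + p) = ISdigit β (ISl β) i) :
    IsIntegral ℤ β ∧ (minpoly ℚ β).natDegree ≤ m + p := by
  obtain ⟨Q, hQ, hdeg, hroot⟩ := exists_monic_aeval_neg_eq_zero hβ hp hper
  refine ⟨by simpa using IsIntegral.neg (⟨Q, hQ, hroot⟩ : IsIntegral ℤ (-β)), ?_⟩
  have hQ' : Q.map (algebraMap ℤ ℚ) ≠ 0 := (hQ.map _).ne_zero
  have hroot' : Polynomial.aeval β ((Q.map (algebraMap ℤ ℚ)).comp (-Polynomial.X)) = 0 := by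
    rw [Polynomial.aeval_comp, map_neg, Polynomial.aeval_X, Polynomial.aeval_map_algebraMap, hroot]
  have hne : (Q.map (algebraMap ℤ ℚ)).comp (-Polynomial.X) ≠ 0 := by
    rwa [Ne, Polynomial.comp_neg_X_eq_zero_iff]
  refine (Polynomial.natDegree_le_of_dvd (minpoly.dvd ℚ β hroot') hne).trans ?_
  rw [Polynomial.natDegree_comp, Polynomial.natDegree_neg, Polynomial.natDegree_X, mul_one,
    hQ.natDegree_map, hdeg]
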